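/- arXiv:math/0012072 — 2 statements merged into one kernel-verified Lean document; each statement's English description precedes it below -/
import Mathlib

section
/- For every real ν with |ν − 1| ≤ 1 and every h > 0, (2/√(2πh³)) · ∫₀^∞ y · e^{−y²/(2h)} · cosh((ν−1)y)/sinh(y) dy = (1/(2√2)) · ∫₀^∞ ϑ(ν/2 | w) · (wh + 1/2)^{−3/2} dw, both integrals being absolutely convergent. -/
open MeasureTheory ProbabilityTheory Real Set

/-- The theta function `ϑ(z|t) = (πt)^{-1/2} Σ_{n ∈ ℤ} exp (-(z+n)²/t)`. -/
noncomputable def theta (z t : ℝ) : ℝ :=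
  (Real.sqrt (Real.pi * t))⁻¹ * ∑' n : ℤ, Real.exp (-(z + n)^2 / t)

/-- The Theta integral `Θ_k(h) = (1/(2√2)) ∫_0^∞ ϑ(ν/2 | w) w^{k-1}/(wh+1/2)^{k+1/2} dw`. -/
noncomputable def ThetaInt (ν h : ℝ) (k : ℕ) : ℝ :=
  (2 * Real.sqrt 2)⁻¹ *
    ∫ w in Set.Ioi (0:ℝ), theta (ν/2) w * w^(k-1) / (w*h + 1/2) ^ ((k:ℝ) + 1/2)

lemma aux_I1_I2 {a s : ℝ} (ha : 0 < a) (hs : 0 < s) :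
    ∫⁻ w in Ioi (0:ℝ), ENNReal.ofReal ((√w)⁻¹ * (rexp (-a^2/w) * rexp (-s^2*w))) =
    ∫⁻ w in Ioi (0:ℝ), ENNReal.ofReal (a/(s*(w*√w)) * (rexp (-a^2/w) * rexp (-s^2*w))) := by
  have him : Set.image (fun w : ℝ => a^2/s^2 * w⁻¹) (Ioi 0) = Ioi 0 := by
    ext v
    simp only [mem_image, mem_Ioi]
    constructor
    · rintro ⟨w, hw, rfl⟩; positivity
    · intro hv
      refine ⟨a^2/s^2 * v⁻¹, by positivity, ?_⟩
      field_simp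
  have h := lintegral_image_eq_lintegral_abs_deriv_mul (s := Ioi (0:ℝ))
    (f := fun w : ℝ => a^2/s^2 * w⁻¹) (f' := fun w => a^2/s^2 * (-(w^2)⁻¹)) measurableSet_Ioi
    (fun x hx => ((hasDerivAt_inv (ne_of_gt hx)).const_mul _).hasDerivWithinAt)
    (by
      intro x hx y hy hxy
      have : a^2/s^2 ≠ 0 := by positivity
      simpa [this, ha.ne', hs.ne'] using hxy)
    (fun w => ENNReal.ofReal ((√w)⁻¹ * (rexp (-a^2/w) * rexp (-s^2*w))))
  rw [him] at h
  rw [h]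
  refine setLIntegral_congr_fun measurableSet_Ioi fun w hw => ?_
  have hw : 0 < w := hw
  rw [← ENNReal.ofReal_mul (abs_nonneg _)]
  congr 1
  have h1 : |a^2/s^2 * (-(w^2)⁻¹)| = a^2/s^2 * (w^2)⁻¹ := by
    rw [mul_neg, abs_neg, abs_of_pos (by positivity)]
  have h2 : √(a^2/s^2 * w⁻¹) = a / s / √w := by
    rw [show a^2/s^2*w⁻¹ = (a/s)^2 / w by field_simp, Real.sqrt_div (by positivity),
      Real.sqrt_sq (by positivity)]
  have h3 : -a^2/(a^2/s^2*w⁻¹) = -s^2*w := by field_simp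
  have h4 : -s^2*(a^2/s^2*w⁻¹) = -a^2/w := by field_simp
  rw [h1, h2, h3, h4, mul_comm (rexp (-s^2*w)), ← mul_assoc]
  congr 1
  have hq : 0 < √w := Real.sqrt_pos.2 hw
  have hq2 : w = √w^2 := (Real.sq_sqrt hw.le).symm
  generalize √w = q at *
  subst hq2
  field_simp

lemma aux_gauss :
    ∫⁻ v : ℝ, ENNReal.ofReal (rexp (-v^2)) = ENNReal.ofReal √π := by
  have h1 := integral_gaussian 1
  have h2 := integrable_exp_neg_mul_sq (b := 1) one_pos
  rw [← ofReal_integral_eq_lintegral_ofReal (by simpa using h2)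
    (Filter.Eventually.of_forall fun x => (exp_pos _).le)]
  simpa using congrArg ENNReal.ofReal h1

lemma aux_sub {a s : ℝ} (ha : 0 < a) (hs : 0 < s) :
    ENNReal.ofReal √π = ∫⁻ w in Ioi (0:ℝ),
      ENNReal.ofReal (rexp (2*a*s) * (s/2) * ((√w)⁻¹ * (rexp (-a^2/w) * rexp (-s^2*w)))
        + rexp (2*a*s) * (s/2) * (a/(s*(w*√w)) * (rexp (-a^2/w) * rexp (-s^2*w)))) := by
  have him : Set.image (fun w : ℝ => s * √w - a * (√w)⁻¹) (Ioi 0) = univ := by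
    refine eq_univ_of_forall fun v => ?_
    have hd : √(v^2+4*a*s)^2 = v^2+4*a*s := Real.sq_sqrt (by positivity)
    have hlt : |v| < √(v^2+4*a*s) := by
      rw [← Real.sqrt_sq_eq_abs]
      exact Real.sqrt_lt_sqrt (by positivity) (by have := mul_pos ha hs; linarith)
    have hpos : 0 < v + √(v^2+4*a*s) := by have := neg_abs_le v; linarith
    generalize √(v^2+4*a*s) = d at *
    refine ⟨((v+d)/(2*s))^2, by simp only [mem_Ioi]; positivity, ?_⟩
    simp only
    rw [Real.sqrt_sq (by positivity)]
    field_simp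
    nlinarith
  have h := lintegral_image_eq_lintegral_abs_deriv_mul (s := Ioi (0:ℝ))
    (f := fun w : ℝ => s * √w - a * (√w)⁻¹)
    (f' := fun w => s * (1/(2*√w)) - a * (-(1/(2*√w)) / √w^2)) measurableSet_Ioi
    (fun x hx => by
      have hx : 0 < x := hx
      have hd := Real.hasDerivAt_sqrt hx.ne'
      exact ((hd.const_mul s).sub ((hd.fun_inv (Real.sqrt_pos.2 hx).ne').const_mul a)).hasDerivWithinAt)
    (by
      have : StrictMonoOn (fun w : ℝ => s * √w - a * (√w)⁻¹) (Ioi 0) := by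
        intro x hx y hy hxy
        have hx : 0 < √x := Real.sqrt_pos.2 hx
        have hl : √x < √y := Real.sqrt_lt_sqrt (by have : (0:ℝ) < x := by assumption
                                                   exact this.le) hxy
        have h1 : (√y)⁻¹ < (√x)⁻¹ := inv_strictAnti₀ hx hl
        simp only
        nlinarith [mul_lt_mul_of_pos_left h1 ha, mul_lt_mul_of_pos_left hl hs]
      exact this.injOn)
    (fun v => ENNReal.ofReal (rexp (-v^2)))
  rw [him, Measure.restrict_univ, aux_gauss] at h
  rw [h]
  refine setLIntegral_congr_fun measurableSet_Ioi fun w hw => ?_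
  have hw : 0 < w := hw
  rw [← ENNReal.ofReal_mul (abs_nonneg _)]
  congr 1
  have hq : 0 < √w := Real.sqrt_pos.2 hw
  have hq2 : w = √w^2 := (Real.sq_sqrt hw.le).symm
  generalize √w = q at *
  subst hq2
  have h1 : s * (1/(2*q)) - a * (-(1/(2*q)) / q^2) = s/2*(q⁻¹ + a/(s*(q^2*q))) := by
    field_simp
    ring
  rw [h1, abs_of_pos (by positivity)]
  have h2 : rexp (-(s*q-a*q⁻¹)^2) = rexp (2*a*s) * (rexp (-a^2/q^2) * rexp (-s^2*q^2)) := by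
    rw [← Real.exp_add, ← Real.exp_add]
    congr 1
    field_simp
    ring
  rw [h2]
  ring

lemma key_pos {a s : ℝ} (ha : 0 < a) (hs : 0 < s) :
    ∫⁻ w in Ioi (0:ℝ), ENNReal.ofReal ((√w)⁻¹ * (rexp (-a^2/w) * rexp (-s^2*w))) =
    ENNReal.ofReal (√π * (rexp (-(2*a*s))/s)) := by
  have h := aux_sub ha hs
  have hC : 0 < rexp (2*a*s) * (s/2) := by positivity
  have e1 : ∫⁻ w in Ioi (0:ℝ),
      ENNReal.ofReal (rexp (2*a*s) * (s/2) * ((√w)⁻¹ * (rexp (-a^2/w) * rexp (-s^2*w)))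
        + rexp (2*a*s) * (s/2) * (a/(s*(w*√w)) * (rexp (-a^2/w) * rexp (-s^2*w)))) =
      ENNReal.ofReal (rexp (2*a*s) * (s/2)) *
        (∫⁻ w in Ioi (0:ℝ), ENNReal.ofReal ((√w)⁻¹ * (rexp (-a^2/w) * rexp (-s^2*w)))) +
      ENNReal.ofReal (rexp (2*a*s) * (s/2)) *
        ∫⁻ w in Ioi (0:ℝ), ENNReal.ofReal (a/(s*(w*√w)) * (rexp (-a^2/w) * rexp (-s^2*w))) := by
    rw [← lintegral_const_mul _ (by fun_prop), ← lintegral_const_mul _ (by fun_prop),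
      ← lintegral_add_left (by fun_prop)]
    refine setLIntegral_congr_fun measurableSet_Ioi fun w hw => ?_
    have hw : 0 < w := hw
    rw [← ENNReal.ofReal_mul hC.le, ← ENNReal.ofReal_mul hC.le,
      ← ENNReal.ofReal_add (by positivity) (by positivity)]
  rw [e1, ← aux_I1_I2 ha hs, ← add_mul, ← ENNReal.ofReal_add hC.le hC.le] at h
  generalize (∫⁻ w in Ioi (0:ℝ), ENNReal.ofReal ((√w)⁻¹ * (rexp (-a^2/w) * rexp (-s^2*w)))) = X at *
  rw [show √π * (rexp (-(2*a*s))/s) = (rexp (-(2*a*s))/s) * √π by ring,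
    ENNReal.ofReal_mul (by positivity), h, ← mul_assoc, ← ENNReal.ofReal_mul (by positivity)]
  rw [Real.exp_neg, show (rexp (2*a*s))⁻¹/s * (rexp (2*a*s) * (s/2) + rexp (2*a*s) * (s/2)) = 1 by
    field_simp
    norm_num]
  simp

lemma key_zero {s : ℝ} (hs : 0 < s) :
    ∫⁻ w in Ioi (0:ℝ), ENNReal.ofReal ((√w)⁻¹ * rexp (-s^2*w)) =
    ENNReal.ofReal (√π * (1/s)) := by
  have h1 := integral_rpow_mul_exp_neg_mul_rpow (p := 1) (q := -1/2) (b := s^2) one_pos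
    (by norm_num) (by positivity)
  have h2 := integrableOn_rpow_mul_exp_neg_mul_rpow (p := 1) (s := -1/2) (b := s^2)
    (by norm_num) one_pos (by positivity)
  have h3 : √π * (1/s) = ∫ (x : ℝ) in Ioi 0, x ^ (-1/2:ℝ) * rexp (-s^2 * x ^ (1:ℝ)) := by
    rw [h1]
    have : ((-1/2 + 1)/1 : ℝ) = 1/2 := by norm_num
    rw [this, Real.Gamma_one_half_eq, ← Real.rpow_natCast, ← Real.rpow_mul hs.le]
    have : ((2:ℕ):ℝ) * (-(-1/2+1)/1) = -1 := by norm_num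
    rw [this, Real.rpow_neg_one]
    ring
  rw [h3, ofReal_integral_eq_lintegral_ofReal h2]
  · refine setLIntegral_congr_fun measurableSet_Ioi fun w hw => ?_
    have hw : 0 < w := hw
    simp only [Real.rpow_one]
    rw [show (-1/2:ℝ) = -(1/2) by norm_num, Real.rpow_neg hw.le, Real.sqrt_eq_rpow]
  · filter_upwards [ae_restrict_mem measurableSet_Ioi] with w hw
    have hw : 0 < w := hw
    simp only [Pi.zero_apply]
    positivity

lemma key {b s : ℝ} (hs : 0 < s) :
    ∫⁻ w in Ioi (0:ℝ), ENNReal.ofReal ((√(π*w))⁻¹ * rexp (-b^2/w) * rexp (-s^2*w)) =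
    ENNReal.ofReal (rexp (-(2*|b| * s))/s) := by
  have hp : ∫⁻ w in Ioi (0:ℝ), ENNReal.ofReal ((√w)⁻¹ * (rexp (-|b|^2/w) * rexp (-s^2*w))) =
    ENNReal.ofReal (√π * (rexp (-(2*|b| * s))/s)) := by
    rcases eq_or_ne b 0 with rfl | hb
    · simpa using key_zero hs
    · exact key_pos (abs_pos.2 hb) hs
  have hpi : 0 < √π := by positivity
  rw [show rexp (-(2*|b| * s))/s = (√π)⁻¹ * (√π * (rexp (-(2*|b| * s))/s)) by field_simp,
    ENNReal.ofReal_mul (by positivity), ← hp, ← lintegral_const_mul _ (by fun_prop)]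
  refine setLIntegral_congr_fun measurableSet_Ioi fun w hw => ?_
  have hw : 0 < w := hw
  rw [← ENNReal.ofReal_mul (by positivity), sq_abs, Real.sqrt_mul Real.pi_pos.le, mul_inv]
  congr 1
  ring

lemma theta_summable (z : ℝ) {w : ℝ} (hw : 0 < w) :
    HasSum (fun n : ℤ => rexp (-(z+n)^2/w)) (HurwitzZeta.evenKernel (z : UnitAddCircle) (1/(π*w))) := by
  have h := HurwitzZeta.hasSum_int_evenKernel z (t := 1/(π*w)) (by positivity)
  refine h.congr_fun ?_
  intro n
  congr 1
  field_simp
  ring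

lemma theta_nonneg (z : ℝ) (w : ℝ) : 0 ≤ theta z w := by
  unfold theta
  exact mul_nonneg (by positivity) (tsum_nonneg fun n => (exp_pos _).le)

lemma theta_aem (z : ℝ) : AEMeasurable (theta z) (volume.restrict (Ioi 0)) := by
  have hc : ContinuousOn (theta z) (Ioi 0) := by
    have : ContinuousOn (fun w : ℝ => (√(π*w))⁻¹ *
        HurwitzZeta.evenKernel (z : UnitAddCircle) (1/(π*w))) (Ioi 0) := by
      refine ContinuousOn.mul ?_ ?_
      · refine ContinuousOn.inv₀ (by fun_prop) fun w hw => ?_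
        have hw : 0 < w := hw
        positivity
      · refine (HurwitzZeta.continuousOn_evenKernel z).comp ?_ ?_
        · refine continuousOn_const.div (by fun_prop) fun w hw => ?_
          have hw : 0 < w := hw
          positivity
        · intro w hw
          have hw : 0 < w := hw
          simp only [mem_Ioi]
          positivity
    refine this.congr fun w hw => ?_
    rw [theta, (theta_summable z hw).tsum_eq]
  exact hc.aemeasurable measurableSet_Ioi

lemma sum_exp {z s : ℝ} (hz0 : 0 ≤ z) (hz1 : z ≤ 1) (hs : 0 < s) :
    HasSum (fun n : ℤ => rexp (-(2*|z+n| * s))/s) (cosh ((2*z-1)*s) / (s * sinh s)) := by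
  have hr : rexp (-(2*s)) < 1 := by rw [Real.exp_lt_one_iff]; linarith
  have hg := hasSum_geometric_of_lt_one (exp_pos (-(2*s))).le hr
  have h1 : HasSum (fun n : ℕ => rexp (-(2*|z+((n:ℤ):ℝ)| * s))/s)
      (rexp (-(2*z*s))/s * (1 - rexp (-(2*s)))⁻¹) := by
    refine (hg.mul_left (rexp (-(2*z*s))/s)).congr_fun ?_
    intro n
    rw [abs_of_nonneg (by push_cast; positivity), ← Real.exp_nat_mul, div_mul_eq_mul_div,
      ← Real.exp_add]
    congr 2
    push_cast
    ring
  have h2 : HasSum (fun n : ℕ => rexp (-(2*|z+((-((n:ℤ)+1):ℤ):ℝ)| * s))/s)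
      (rexp (-(2*(1-z)*s))/s * (1 - rexp (-(2*s)))⁻¹) := by
    refine (hg.mul_left (rexp (-(2*(1-z)*s))/s)).congr_fun ?_
    intro n
    have hn : (0:ℝ) ≤ n := by positivity
    rw [abs_of_nonpos (by push_cast; linarith), ← Real.exp_nat_mul, div_mul_eq_mul_div,
      ← Real.exp_add]
    congr 2
    push_cast
    ring
  have h := HasSum.of_nat_of_neg_add_one (f := fun n : ℤ => rexp (-(2*|z+n| * s))/s) h1 h2
  convert h using 1
  have hsh : 0 < sinh s := Real.sinh_pos_iff.2 hs
  have h3 : 0 < 1 - rexp (-(2*s)) := by linarith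
  rw [← add_mul, ← div_eq_mul_inv, ← add_div, div_div, div_eq_div_iff (by positivity) (by positivity)]
  have e1 : 1 - rexp (-(2*s)) = 2 * rexp (-s) * sinh s := by
    rw [Real.sinh_eq, show -(2*s) = -s + -s by ring, Real.exp_add]
    have : rexp (-s) * rexp s = 1 := by rw [← Real.exp_add]; simp
    linear_combination -this
  have e2 : rexp (-(2*z*s)) + rexp (-(2*(1-z)*s)) = 2 * rexp (-s) * cosh ((2*z-1)*s) := by
    rw [Real.cosh_eq, show -(2*z*s) = -s + -((2*z-1)*s) by ring,
      show -(2*(1-z)*s) = -s + (2*z-1)*s by ring, Real.exp_add, Real.exp_add]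
    ring
  rw [e1, e2]
  ring

lemma lap {z s : ℝ} (hz0 : 0 ≤ z) (hz1 : z ≤ 1) (hs : 0 < s) :
    ∫⁻ w in Ioi (0:ℝ), ENNReal.ofReal (theta z w * rexp (-s^2*w)) =
    ENNReal.ofReal (cosh ((2*z-1)*s) / (s * sinh s)) := by
  have hsum := sum_exp hz0 hz1 hs
  rw [← hsum.tsum_eq, ENNReal.ofReal_tsum_of_nonneg (fun n => by positivity) hsum.summable]
  simp_rw [← key hs]
  rw [← lintegral_tsum (fun n => by fun_prop)]
  refine setLIntegral_congr_fun measurableSet_Ioi fun w hw => ?_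
  have hw : 0 < w := hw
  have hS := (theta_summable z hw).summable
  rw [← ENNReal.ofReal_tsum_of_nonneg (fun n => by positivity) ((hS.mul_left _).mul_right _)]
  rw [tsum_mul_right, tsum_mul_left, theta]

lemma gauss2 {c : ℝ} (hc : 0 < c) :
    ∫⁻ y in Ioi (0:ℝ), ENNReal.ofReal (y^2 * rexp (-c*y^2)) =
    ENNReal.ofReal (√π/4 * c^(-(3:ℝ)/2)) := by
  have h1 := integral_rpow_mul_exp_neg_mul_rpow (p := 2) (q := 2) (b := c) two_pos
    (by norm_num) hc
  have h2 := integrableOn_rpow_mul_exp_neg_mul_rpow (p := 2) (s := 2) (b := c)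
    (by norm_num) two_pos hc
  have h3 : √π/4 * c^(-(3:ℝ)/2) = ∫ (x : ℝ) in Ioi 0, x ^ (2:ℝ) * rexp (-c * x ^ (2:ℝ)) := by
    rw [h1]
    have : ((2 + 1)/2 : ℝ) = 1/2 + 1 := by norm_num
    rw [this, Real.Gamma_add_one (by norm_num), Real.Gamma_one_half_eq,
      show (-(2+1)/2:ℝ) = -3/2 by norm_num]
    ring
  rw [h3, ofReal_integral_eq_lintegral_ofReal h2]
  · refine setLIntegral_congr_fun measurableSet_Ioi fun w hw => ?_
    simp only [Real.rpow_ofNat]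
  · filter_upwards [ae_restrict_mem measurableSet_Ioi] with w hw
    have hw : 0 < w := hw
    simp only [Pi.zero_apply]
    positivity

lemma main_lintegral {ν h : ℝ} (h0 : 0 ≤ ν/2) (h1 : ν/2 ≤ 1) (hh : 0 < h) :
    ∫⁻ y in Ioi (0:ℝ), ENNReal.ofReal
      (y * Real.exp (-y^2/(2*h)) * (Real.cosh ((ν-1)*y) / Real.sinh y)) =
    ENNReal.ofReal (√π/4 * h^((3:ℝ)/2)) *
      ∫⁻ w in Ioi (0:ℝ), ENNReal.ofReal (theta (ν/2) w * (w*h + 1/2) ^ (-(3:ℝ)/2)) := by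
  have hth := theta_aem (ν/2)
  calc _ = ∫⁻ y in Ioi (0:ℝ), ∫⁻ w in Ioi (0:ℝ), ENNReal.ofReal
        (y^2 * rexp (-y^2/(2*h)) * (theta (ν/2) w * rexp (-y^2*w))) := by
        refine setLIntegral_congr_fun measurableSet_Ioi fun y hy => ?_
        have hy : 0 < y := hy
        have hsh : 0 < sinh y := Real.sinh_pos_iff.2 hy
        have hl := lap h0 h1 hy
        simp_rw [ENNReal.ofReal_mul (show 0 ≤ y^2 * rexp (-y^2/(2*h)) by positivity)]
        rw [lintegral_const_mul'' _ (by fun_prop), hl, ← ENNReal.ofReal_mul (by positivity)]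
        congr 1
        rw [show 2*(ν/2)-1 = ν-1 by ring]
        field_simp
    _ = ∫⁻ w in Ioi (0:ℝ), ∫⁻ y in Ioi (0:ℝ), ENNReal.ofReal
        (y^2 * rexp (-y^2/(2*h)) * (theta (ν/2) w * rexp (-y^2*w))) := by
        refine lintegral_lintegral_swap ?_
        have : AEMeasurable (fun p : ℝ × ℝ => theta (ν/2) p.2)
          ((volume.restrict (Ioi 0)).prod (volume.restrict (Ioi 0))) := hth.comp_snd
        simp only [Function.uncurry_def]
        fun_prop
    _ = ∫⁻ w in Ioi (0:ℝ), ENNReal.ofReal (√π/4 * h^((3:ℝ)/2)) *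
          ENNReal.ofReal (theta (ν/2) w * (w*h + 1/2) ^ (-(3:ℝ)/2)) := by
        refine setLIntegral_congr_fun measurableSet_Ioi fun w hw => ?_
        have hw : 0 < w := hw
        have hg := gauss2 (c := (w*h+1/2)/h) (by positivity)
        have : ∀ y : ℝ, ENNReal.ofReal
          (y^2 * rexp (-y^2/(2*h)) * (theta (ν/2) w * rexp (-y^2*w))) =
          ENNReal.ofReal (theta (ν/2) w) *
            ENNReal.ofReal (y^2 * rexp (-((w*h+1/2)/h)*y^2)) := by
          intro y
          rw [← ENNReal.ofReal_mul (theta_nonneg _ _)]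
          congr 1
          rw [show -((w*h+1/2)/h)*y^2 = -y^2/(2*h) + -y^2*w by field_simp; ring, Real.exp_add]
          ring
        simp_rw [this]
        rw [lintegral_const_mul _ (by fun_prop), hg, ← ENNReal.ofReal_mul (theta_nonneg _ _),
          ← ENNReal.ofReal_mul (by positivity)]
        congr 1
        rw [Real.div_rpow (by positivity) hh.le, show (-3/2:ℝ) = -(3/2) by norm_num,
          Real.rpow_neg hh.le]
        field_simp
    _ = _ := by
        rw [lintegral_const_mul'']
        fun_prop

/-- For `|ν-1| ≤ 1` and `h > 0`, Dufresne's integral for the first negative moment equals the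
Theta integral `Θ₁(h)`, both integrals being absolutely convergent. -/
theorem dufresne_integral_eq_theta_integral
    (ν : ℝ) (hν : |ν - 1| ≤ 1) (h : ℝ) (hh : 0 < h) :
    IntegrableOn
      (fun y => y * Real.exp (-y^2/(2*h)) * (Real.cosh ((ν-1)*y) / Real.sinh y))
      (Set.Ioi 0) volume ∧
    IntegrableOn
      (fun w => theta (ν/2) w * (w*h + 1/2) ^ (-(3:ℝ)/2)) (Set.Ioi 0) volume ∧
    (2 / Real.sqrt (2*Real.pi*h^3)) *
        ∫ y in Set.Ioi (0:ℝ), y * Real.exp (-y^2/(2*h)) * (Real.cosh ((ν-1)*y) / Real.sinh y)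
      = (2 * Real.sqrt 2)⁻¹ *
        ∫ w in Set.Ioi (0:ℝ), theta (ν/2) w * (w*h + 1/2) ^ (-(3:ℝ)/2) := by
  obtain ⟨hl, hu⟩ := abs_le.1 hν
  have hmain := main_lintegral (ν := ν) (h := h) (by linarith) (by linarith) hh
  have hth := theta_aem (ν/2)
  have hc : 0 < √π/4 * h^((3:ℝ)/2) := by positivity
  have hLm : AEStronglyMeasurable
      (fun y => y * Real.exp (-y^2/(2*h)) * (Real.cosh ((ν-1)*y) / Real.sinh y))
      (volume.restrict (Ioi 0)) := by
    have hs1 : Measurable Real.sinh := Real.continuous_sinh.measurable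
    have hs2 : Measurable (fun y : ℝ => Real.cosh ((ν-1)*y)) :=
      (Real.continuous_cosh.comp (by fun_prop)).measurable
    exact ((by fun_prop : Measurable (fun y : ℝ => y * Real.exp (-y^2/(2*h)))).mul
      (hs2.div hs1)).aestronglyMeasurable
  have hLn : 0 ≤ᵐ[volume.restrict (Ioi 0)]
      (fun y => y * Real.exp (-y^2/(2*h)) * (Real.cosh ((ν-1)*y) / Real.sinh y)) := by
    filter_upwards [ae_restrict_mem measurableSet_Ioi] with y hy
    have hy : 0 < y := hy
    have hsh : 0 < sinh y := Real.sinh_pos_iff.2 hy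
    simp only [Pi.zero_apply]
    positivity
  have hRm : AEStronglyMeasurable
      (fun w => theta (ν/2) w * (w*h + 1/2) ^ (-(3:ℝ)/2)) (volume.restrict (Ioi 0)) :=
    AEMeasurable.aestronglyMeasurable (by fun_prop)
  have hRn : 0 ≤ᵐ[volume.restrict (Ioi 0)]
      (fun w => theta (ν/2) w * (w*h + 1/2) ^ (-(3:ℝ)/2)) := by
    filter_upwards [ae_restrict_mem measurableSet_Ioi] with w hw
    have hw : 0 < w := hw
    have := theta_nonneg (ν/2) w
    simp only [Pi.zero_apply]
    positivity
  have hLi : IntegrableOn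
      (fun y => y * Real.exp (-y^2/(2*h)) * (Real.cosh ((ν-1)*y) / Real.sinh y))
      (Set.Ioi 0) volume := by
    have hb : (0:ℝ) < 1/(2*h) := by positivity
    have hi := ((integrable_exp_neg_mul_sq hb).add (integrable_mul_exp_neg_mul_sq hb)).integrableOn
      (s := Ioi (0:ℝ))
    refine Integrable.mono' hi hLm ?_
    filter_upwards [ae_restrict_mem measurableSet_Ioi, hLn] with y hy hn
    have hy : 0 < y := hy
    have hsh : 0 < sinh y := Real.sinh_pos_iff.2 hy
    rw [Real.norm_of_nonneg hn]
    have e1 : cosh ((ν-1)*y) ≤ cosh y := by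
      rw [Real.cosh_le_cosh, abs_mul, abs_of_pos hy]
      nlinarith
    have e2 : cosh y ≤ sinh y + 1 := by
      have := Real.cosh_sub_sinh y
      have : rexp (-y) ≤ 1 := Real.exp_le_one_iff.2 (by linarith)
      linarith
    have e3 : y ≤ sinh y := Real.self_le_sinh_iff.2 hy.le
    have e4 : y * (cosh ((ν-1)*y) / sinh y) ≤ 1 + y := by
      rw [← mul_div_assoc, div_le_iff₀ hsh]
      nlinarith
    have e5 : rexp (-y^2/(2*h)) = rexp (-(1/(2*h)) * y^2) := by
      congr 1; ring
    simp only [Pi.add_apply]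
    rw [← e5]
    nlinarith [exp_pos (-y^2/(2*h))]
  have hLf := (hasFiniteIntegral_iff_ofReal hLn).1 hLi.2
  have hRi : IntegrableOn
      (fun w => theta (ν/2) w * (w*h + 1/2) ^ (-(3:ℝ)/2)) (Set.Ioi 0) volume := by
    refine ⟨hRm, (hasFiniteIntegral_iff_ofReal hRn).2 ?_⟩
    rw [hmain] at hLf
    by_contra hcon
    rw [not_lt, top_le_iff] at hcon
    rw [hcon, ENNReal.mul_top (by simpa using hc)] at hLf
    exact lt_irrefl _ hLf
  refine ⟨hLi, hRi, ?_⟩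
  rw [integral_eq_lintegral_of_nonneg_ae hLn hLm, integral_eq_lintegral_of_nonneg_ae hRn hRm,
    hmain, ENNReal.toReal_mul, ENNReal.toReal_ofReal hc.le, ← mul_assoc]
  congr 1
  have e : h^((3:ℝ)/2) = √(h^3) := by
    rw [Real.sqrt_eq_rpow, ← Real.rpow_natCast, ← Real.rpow_mul hh.le]
    norm_num
  rw [e, Real.sqrt_mul (by positivity), Real.sqrt_mul (by positivity)]
  field_simp
  norm_num
end

section
/- For every ν ∈ ℝ, h > 0, b ∈ ℝ and every a < 1/2, the function x ↦ e^{ax} · x^{−b} · α_{ν,h}(x) is well defined, bounded on (0,∞), and Lebesgue integrable on (0,∞); in particular it extends to a bounded integrable function on the non-negative real line. -/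
open MeasureTheory Real Set

/-- `ψ_ξ(h) = ∫_0^∞ exp (-w²/(2h) - ξ cosh w) sinh w sin (πw/h) dw`. -/
noncomputable def psi (h ξ : ℝ) : ℝ :=
  ∫ w in Set.Ioi (0:ℝ),
    Real.exp (-w^2/(2*h) - ξ * Real.cosh w) * Real.sinh w * Real.sin (Real.pi * w / h)

/-- Yor's Asia density `α_{ν,h}(x) = e^{-x/2} ∫_0^∞ y^ν e^{-x y²/2} ψ_{xy}(h) dy`. -/
noncomputable def asiaDensity (ν h x : ℝ) : ℝ :=
  Real.exp (-x/2) * ∫ y in Set.Ioi (0:ℝ), y ^ ν * Real.exp (-x*y^2/2) * psi h (x*y)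

/-- Taylor remainder of the exponential on the negative half-line. -/
lemma asia_taylor (N : ℕ) (hN : 0 < N) :
    ∃ C : ℝ, 0 ≤ C ∧ ∀ z : ℝ, 0 ≤ z →
      |Real.exp (-z) - ∑ k ∈ Finset.range N, (-z) ^ k / (k.factorial : ℝ)| ≤ C * z ^ N := by
  refine ⟨((N.succ : ℝ) / (N.factorial * N)) + (N + 1), by positivity, fun z hz => ?_⟩
  have hzN : 0 ≤ z ^ N := by positivity
  have hA : 0 ≤ ((N.succ : ℝ) / (N.factorial * N)) := by positivity
  by_cases h1 : z ≤ 1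
  · have := Real.exp_bound (x := -z) (by rwa [abs_neg, abs_of_nonneg hz]) hN
    rw [abs_neg, abs_of_nonneg hz] at this
    refine this.trans ?_
    nlinarith [mul_nonneg hzN (by positivity : (0:ℝ) ≤ N + 1)]
  · push Not at h1
    have h2 : |∑ k ∈ Finset.range N, (-z) ^ k / (k.factorial : ℝ)| ≤ N * z ^ N := by
      refine (Finset.abs_sum_le_sum_abs _ _).trans ?_
      have : ∀ k ∈ Finset.range N, |(-z) ^ k / (k.factorial : ℝ)| ≤ z ^ N := by
        intro k hk
        rw [abs_div, abs_pow, abs_neg, abs_of_nonneg hz, Nat.abs_cast]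
        have h3 : (1:ℝ) ≤ k.factorial := by exact_mod_cast Nat.factorial_pos k
        refine (div_le_self (by positivity) h3).trans ?_
        exact pow_le_pow_right₀ h1.le (Finset.mem_range.1 hk).le
      simpa using Finset.sum_le_sum this
    have h4 : |Real.exp (-z)| ≤ z ^ N := by
      rw [abs_of_pos (Real.exp_pos _)]
      exact (Real.exp_le_one_iff.2 (by linarith)).trans (one_le_pow₀ h1.le)
    refine (abs_sub _ _).trans ?_
    nlinarith [mul_nonneg hzN hA]

/-- The Gaussian times exponentials. -/
lemma asia_integrable (h : ℝ) (hh : 0 < h) (k : ℕ) : ∀ m : ℝ,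
    Integrable (fun w : ℝ => Real.exp (-w^2/(2*h)) * Real.exp (m*w) * Real.cosh w ^ k) := by
  induction k with
  | zero =>
    intro m
    have hb : 0 < ((1/(2*h) : ℝ) : ℂ).re := by rw [Complex.ofReal_re]; positivity
    have := (integrable_cexp_quadratic hb (m:ℂ) 0).re
    refine this.congr (Filter.Eventually.of_forall fun w => ?_)
    have e : (-((1/(2*h) : ℝ) : ℂ) * (w:ℂ)^2 + (m:ℂ) * w + 0)
        = ((-w^2/(2*h) + m*w : ℝ) : ℂ) := by
      push_cast; ring
    simp only [e]
    rw [← Complex.ofReal_exp]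
    change (((Real.exp (-w^2/(2*h) + m*w) : ℝ)) : ℂ).re = _
    rw [Complex.ofReal_re, Real.exp_add, pow_zero, mul_one]
  | succ k ih =>
    intro m
    refine (((ih (m+1)).add (ih (m-1))).div_const 2).congr
      (Filter.Eventually.of_forall fun w => ?_)
    simp only [Pi.add_apply]
    rw [pow_succ (Real.cosh w)]
    generalize Real.cosh w ^ k = D
    rw [Real.cosh_eq w, add_mul, sub_mul, Real.exp_add, Real.exp_sub, one_mul,
      Real.exp_neg]
    field_simp

lemma asia_integrable_sin (h : ℝ) (hh : 0 < h) (k : ℕ) (m : ℝ) :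
    Integrable (fun w : ℝ => Real.exp (-w^2/(2*h)) * Real.exp (m*w) * Real.cosh w ^ k
      * Real.sin (Real.pi * w / h)) := by
  refine (asia_integrable h hh k m).mul_bdd (c := 1)
    (Continuous.aestronglyMeasurable (by fun_prop)) ?_
  exact Filter.Eventually.of_forall fun w => Real.abs_sin_le_one _

lemma asia_moment (h : ℝ) (hh : 0 < h) (k : ℕ) : ∀ m : ℤ,
    ∫ w : ℝ, Real.exp (-w^2/(2*h)) * Real.exp ((m:ℝ)*w) * Real.cosh w ^ k
      * Real.sin (Real.pi * w / h) = 0 := by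
  induction k with
  | zero =>
    intro m
    have hb : (-((1/(2*h) : ℝ) : ℂ)).re < 0 := by
      rw [Complex.neg_re, Complex.ofReal_re]
      have : 0 < 1/(2*h) := by positivity
      linarith
    have hb' : 0 < ((1/(2*h) : ℝ) : ℂ).re := by rw [Complex.ofReal_re]; positivity
    have h1 := integral_cexp_quadratic hb ((m:ℂ) + (Real.pi/h : ℝ) * Complex.I) 0
    have h2 := integrable_cexp_quadratic hb' ((m:ℂ) + (Real.pi/h : ℝ) * Complex.I) 0
    have h3 := integral_im h2
    have h4 : ∀ w : ℝ, RCLike.im (Complex.exp (-((1/(2*h) : ℝ) : ℂ) * (w:ℂ)^2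
        + ((m:ℂ) + (Real.pi/h : ℝ) * Complex.I) * w + 0))
        = Real.exp (-w^2/(2*h)) * Real.exp ((m:ℝ)*w) * Real.cosh w ^ 0
      * Real.sin (Real.pi * w / h) := by
      intro w
      have e : (-((1/(2*h) : ℝ) : ℂ) * (w:ℂ)^2
        + ((m:ℂ) + (Real.pi/h : ℝ) * Complex.I) * w + 0)
        = ((-w^2/(2*h) + m*w : ℝ) : ℂ) + ((Real.pi * w / h : ℝ) : ℂ) * Complex.I := by
        push_cast; ring
      rw [e]
      change (Complex.exp _).im = _
      rw [Complex.exp_im]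
      simp [-Complex.ofReal_mul, -Complex.ofReal_div, Real.exp_add]
    simp only [h4] at h3
    rw [h3, h1]
    have hc : (h:ℂ) ≠ 0 := by exact_mod_cast hh.ne'
    have e2 : (0 : ℂ) - ((m:ℂ) + (Real.pi/h : ℝ) * Complex.I)^2 / (4 * -((1/(2*h) : ℝ) : ℂ))
        = ((h * m^2/2 - Real.pi^2/(2*h) : ℝ) : ℂ) + ((m * Real.pi : ℝ):ℂ) * Complex.I := by
      push_cast
      field_simp
      ring_nf
      simp only [Complex.I_sq]
      ring
    have e3 : ((Real.pi:ℂ) / -(-((1/(2*h) : ℝ) : ℂ))) ^ (1/2 : ℂ)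
        = (((Real.pi / (1/(2*h))) ^ (1/2 : ℝ) : ℝ) : ℂ) := by
      rw [Complex.ofReal_cpow (by positivity)]
      push_cast
      simp
    rw [e2, e3]
    change (_ * Complex.exp _).im = 0
    rw [Complex.im_ofReal_mul, Complex.exp_im]
    simp [-Complex.ofReal_mul, -Complex.ofReal_div, Real.sin_int_mul_pi]
  | succ k ih =>
    intro m
    have h1 := ih (m+1)
    have h2 := ih (m-1)
    have i1 := asia_integrable_sin h hh k ((m+1 : ℤ) : ℝ)
    have i2 := asia_integrable_sin h hh k ((m-1 : ℤ) : ℝ)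
    have h3 := integral_add i1 i2
    rw [h1, h2, add_zero] at h3
    rw [← zero_div (2:ℝ), ← h3, ← integral_div]
    congr 1
    funext w
    push_cast
    rw [pow_succ (Real.cosh w)]
    generalize Real.cosh w ^ k = D
    rw [Real.cosh_eq w, add_mul, sub_mul, Real.exp_add, Real.exp_sub, one_mul,
      Real.exp_neg]
    field_simp

lemma asia_moment' (h : ℝ) (hh : 0 < h) (k : ℕ) :
    ∫ w in Ioi (0:ℝ), Real.exp (-w^2/(2*h)) * Real.cosh w ^ k * Real.sinh w
      * Real.sin (Real.pi * w / h) = 0 := by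
  set f : ℝ → ℝ := fun w => Real.exp (-w^2/(2*h)) * Real.cosh w ^ k * Real.sinh w
      * Real.sin (Real.pi * w / h) with hf
  have heven : ∀ w, f |w| = f w := by
    intro w
    rcases abs_choice w with e | e <;> rw [e]
    simp only [hf]
    rw [Real.cosh_neg, Real.sinh_neg, neg_sq, show Real.pi * -w / h = -(Real.pi * w / h) by ring, Real.sin_neg]
    ring
  have h1 := integral_comp_abs (f := f)
  simp only [heven] at h1
  have i1 := asia_integrable_sin h hh k ((1 : ℤ) : ℝ)
  have i2 := asia_integrable_sin h hh k ((-1 : ℤ) : ℝ)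
  have h3 := integral_sub i1 i2
  rw [asia_moment h hh k 1, asia_moment h hh k (-1), sub_zero] at h3
  have h4 : ∫ w, f w = 0 := by
    rw [← zero_div (2:ℝ), ← h3, ← integral_div]
    congr 1
    funext w
    simp only [hf]
    rw [Real.sinh_eq]
    push_cast
    rw [one_mul, neg_one_mul]
    ring
  linarith

lemma asia_integrable_cosh (h : ℝ) (hh : 0 < h) (k : ℕ) :
    Integrable (fun w : ℝ => Real.exp (-w^2/(2*h)) * Real.cosh w ^ k) := by
  simpa using asia_integrable h hh k 0

lemma asia_sinh_le (w : ℝ) : |Real.sinh w| ≤ Real.cosh w := by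
  rw [← Real.cosh_abs, abs_sinh]
  exact (Real.sinh_lt_cosh _).le

lemma asia_psi_bound (h : ℝ) (hh : 0 < h) (N : ℕ) (hN : 0 < N) :
    ∃ C : ℝ, 0 ≤ C ∧ ∀ ξ : ℝ, 0 < ξ → |psi h ξ| ≤ C * ξ ^ N := by
  obtain ⟨C, hC, hT⟩ := asia_taylor N hN
  refine ⟨C * ∫ w in Ioi (0:ℝ), Real.exp (-w^2/(2*h)) * Real.cosh w ^ (N+1), ?_, ?_⟩
  · exact mul_nonneg hC (setIntegral_nonneg measurableSet_Ioi fun w _ => by positivity)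
  intro ξ hξ
  have hgen : ∀ w A B : ℝ, |Real.exp (-w^2/(2*h)) * A * Real.sinh w * B| ≤
      Real.exp (-w^2/(2*h)) * |A| * Real.cosh w * |B| := by
    intro w A B
    rw [abs_mul, abs_mul, abs_mul, Real.abs_exp]
    gcongr
    exact asia_sinh_le w
  have hmom : ∀ k, Integrable (fun w => Real.exp (-w^2/(2*h)) * Real.cosh w ^ k * Real.sinh w
      * Real.sin (Real.pi * w / h)) (volume.restrict (Ioi (0:ℝ))) := by
    intro k
    refine ((asia_integrable_cosh h hh (k+1)).mono'
      (Continuous.aestronglyMeasurable (by fun_prop))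
      (Filter.Eventually.of_forall fun w => ?_)).restrict
    refine (hgen w _ _).trans ?_
    rw [abs_of_pos (by positivity : 0 < Real.cosh w ^ k), pow_succ (Real.cosh w), ← mul_assoc]
    exact mul_le_of_le_one_right (by positivity) (Real.abs_sin_le_one _)
  have hF : Integrable (fun w => Real.exp (-w^2/(2*h) - ξ * Real.cosh w) * Real.sinh w
      * Real.sin (Real.pi * w / h)) (volume.restrict (Ioi (0:ℝ))) := by
    refine ((asia_integrable_cosh h hh 1).mono'
      (Continuous.aestronglyMeasurable (by fun_prop))
      (Filter.Eventually.of_forall fun w => ?_)).restrict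
    rw [sub_eq_add_neg, Real.exp_add]
    refine (hgen w _ _).trans ?_
    refine (mul_le_of_le_one_right (by positivity) (Real.abs_sin_le_one _)).trans ?_
    rw [Real.abs_exp, pow_one]
    have : Real.exp (-(ξ * Real.cosh w)) ≤ 1 :=
      Real.exp_le_one_iff.2 (neg_nonpos.2 (by positivity))
    gcongr
    exact mul_le_of_le_one_right (by positivity) this
  have hTi : ∀ k ∈ Finset.range N, Integrable (fun w => ((-ξ)^k / (k.factorial : ℝ)) *
      (Real.exp (-w^2/(2*h)) * Real.cosh w ^ k * Real.sinh w
      * Real.sin (Real.pi * w / h))) (volume.restrict (Ioi (0:ℝ))) :=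
    fun k _ => (hmom k).const_mul _
  have hT0 : ∫ w in Ioi (0:ℝ), ∑ k ∈ Finset.range N, ((-ξ)^k / (k.factorial : ℝ)) *
      (Real.exp (-w^2/(2*h)) * Real.cosh w ^ k * Real.sinh w
      * Real.sin (Real.pi * w / h)) = 0 := by
    rw [integral_finsetSum _ hTi]
    refine Finset.sum_eq_zero fun k _ => ?_
    rw [integral_const_mul, asia_moment' h hh k, mul_zero]
  have hsub := integral_sub hF (integrable_finsetSum _ hTi)
  rw [hT0, sub_zero] at hsub
  unfold psi
  rw [← hsub, mul_right_comm, ← integral_const_mul]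
  rw [← Real.norm_eq_abs]
  refine norm_integral_le_of_norm_le
    ((asia_integrable_cosh h hh (N+1)).restrict.const_mul (C * ξ^N))
    (Filter.Eventually.of_forall fun w => ?_)
  have e : Real.exp (-w^2/(2*h) - ξ * Real.cosh w) * Real.sinh w * Real.sin (Real.pi * w / h)
      - ∑ k ∈ Finset.range N, ((-ξ)^k / (k.factorial : ℝ)) *
      (Real.exp (-w^2/(2*h)) * Real.cosh w ^ k * Real.sinh w * Real.sin (Real.pi * w / h))
      = Real.exp (-w^2/(2*h)) * (Real.exp (-(ξ * Real.cosh w))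
        - ∑ k ∈ Finset.range N, (-(ξ * Real.cosh w)) ^ k / (k.factorial : ℝ))
        * Real.sinh w * Real.sin (Real.pi * w / h) := by
    rw [sub_eq_add_neg (-w^2/(2*h)), Real.exp_add, mul_sub, sub_mul, sub_mul, Finset.mul_sum,
      Finset.sum_mul, Finset.sum_mul]
    congr 1
    refine Finset.sum_congr rfl fun k _ => ?_
    rw [← neg_mul, mul_pow]
    ring
  rw [e]
  refine (hgen w _ _).trans ?_
  refine (mul_le_of_le_one_right (by positivity) (Real.abs_sin_le_one _)).trans ?_
  have := hT (ξ * Real.cosh w) (by positivity)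
  calc _ ≤ Real.exp (-w^2/(2*h)) * (C * (ξ * Real.cosh w)^N) * Real.cosh w := by gcongr
    _ = _ := by rw [mul_pow]; ring

lemma asia_bound (ν h : ℝ) (hh : 0 < h) (N : ℕ) (hN : 0 < N) (hνN : -1 < ν + N) :
    ∃ C : ℝ, 0 ≤ C ∧ ∀ x : ℝ, 0 < x →
      |asiaDensity ν h x| ≤ C * Real.exp (-x/2) * x ^ (((N:ℝ) - ν - 1)/2) := by
  obtain ⟨C, hC, hb⟩ := asia_psi_bound h hh N hN
  have hG : 0 < Real.Gamma ((ν + N + 1)/2) := Real.Gamma_pos_of_pos (by linarith)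
  refine ⟨C * ((1/2:ℝ) ^ (-(ν+N+1)/2) * (1/2) * Real.Gamma ((ν + N + 1)/2)), by positivity, ?_⟩
  intro x hx
  have hi := (integrableOn_rpow_mul_exp_neg_mul_rpow (p := 2) (s := ν + N) (b := x/2) hνN
    two_pos (by positivity)).const_mul (C * x^N)
  have hv := integral_rpow_mul_exp_neg_mul_rpow (p := 2) (q := ν + N) (b := x/2)
    two_pos hνN (by positivity)
  have hle : |∫ y in Set.Ioi (0:ℝ), y ^ ν * Real.exp (-x*y^2/2) * psi h (x*y)| ≤
      ∫ y in Set.Ioi (0:ℝ), C * x^N * (y ^ (ν + N) * Real.exp (-(x/2) * y ^ (2:ℝ))) := by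
    rw [← Real.norm_eq_abs]
    refine norm_integral_le_of_norm_le hi ?_
    filter_upwards [ae_restrict_mem measurableSet_Ioi] with y hy
    have hy : 0 < y := hy
    rw [Real.norm_eq_abs, abs_mul, abs_mul, Real.abs_exp, abs_of_pos (Real.rpow_pos_of_pos hy _)]
    have := hb (x*y) (by positivity)
    calc _ ≤ y ^ ν * Real.exp (-x*y^2/2) * (C * (x*y)^N) := by gcongr
      _ = _ := by
        rw [Real.rpow_add hy, Real.rpow_natCast, mul_pow, Real.rpow_two]
        rw [show -x*y^2/2 = -(x/2)*y^2 by ring]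
        ring
  rw [integral_const_mul, hv] at hle
  unfold asiaDensity
  rw [abs_mul, Real.abs_exp]
  refine (mul_le_mul_of_nonneg_left hle (Real.exp_pos _).le).trans (le_of_eq ?_)
  have e : x ^ N * (x/2) ^ (-(ν+N+1)/2) = (1/2:ℝ) ^ (-(ν+N+1)/2) * x ^ (((N:ℝ) - ν - 1)/2) := by
    rw [show x/2 = (1/2) * x by ring, Real.mul_rpow (by norm_num) hx.le,
      show ((N:ℝ) - ν - 1)/2 = N + -(ν+N+1)/2 by ring, Real.rpow_add hx, Real.rpow_natCast]
    ring
  linear_combination (Real.exp (-x/2) * C * (1/2) * Real.Gamma ((ν + N + 1)/2)) * e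

lemma asia_measurable (ν h : ℝ) : Measurable (asiaDensity ν h) := by
  have hpsi : Measurable (psi h) := by
    unfold psi
    refine (StronglyMeasurable.integral_prod_right (f := fun ξ w : ℝ =>
      Real.exp (-w^2/(2*h) - ξ * Real.cosh w) * Real.sinh w * Real.sin (Real.pi * w / h))
      ?_).measurable
    apply Continuous.stronglyMeasurable
    unfold Function.uncurry
    fun_prop
  unfold asiaDensity
  refine Measurable.mul (by fun_prop) ?_
  refine (StronglyMeasurable.integral_prod_right (f := fun x y : ℝ =>
    y ^ ν * Real.exp (-x*y^2/2) * psi h (x*y)) ?_).measurable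
  apply Measurable.stronglyMeasurable
  unfold Function.uncurry
  fun_prop

/-- For `a < 1/2`, the map `x ↦ e^{ax} x^{-b} α_{ν,h}(x)` is bounded and Lebesgue integrable
on `(0,∞)`; in particular it extends to a bounded integrable map on the non-negative reals. -/
theorem asiaDensity_weighted_bounded_integrable
    (ν h b a : ℝ) (hh : 0 < h) (ha : a < 1/2) :
    (∃ M : ℝ, ∀ x ∈ Set.Ioi (0:ℝ),
      |Real.exp (a*x) * x ^ (-b) * asiaDensity ν h x| ≤ M) ∧
    IntegrableOn (fun x => Real.exp (a*x) * x ^ (-b) * asiaDensity ν h x)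
      (Set.Ioi 0) volume := by
  obtain ⟨N, hN⟩ := exists_nat_gt (max 0 (max (-1 - ν) (ν + 1 + 2 * (b + 1))))
  simp only [max_lt_iff] at hN
  obtain ⟨hN0, hN1, hN2⟩ := hN
  obtain ⟨C, hC, hbd⟩ := asia_bound ν h hh N (by exact_mod_cast hN0) (by linarith)
  set s : ℝ := ((N:ℝ) - ν - 1)/2 - b with hs
  have hs0 : 0 < s := by linarith
  set c : ℝ := 1/2 - a with hc
  have hc0 : 0 < c := by linarith
  have key : ∀ x : ℝ, 0 < x → |Real.exp (a*x) * x ^ (-b) * asiaDensity ν h x| ≤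
      C * (x ^ s * Real.exp (-c * x ^ (1:ℝ))) := by
    intro x hx
    rw [abs_mul, abs_mul, Real.abs_exp, abs_of_pos (Real.rpow_pos_of_pos hx _)]
    calc _ ≤ Real.exp (a*x) * x ^ (-b) * (C * Real.exp (-x/2) * x ^ (((N:ℝ) - ν - 1)/2)) := by
            gcongr; exact hbd x hx
      _ = _ := by
        rw [Real.rpow_one, show -c * x = a*x + -x/2 by rw [hc]; ring, Real.exp_add, hs,
          sub_eq_add_neg _ b, Real.rpow_add hx]
        ring
  constructor
  · refine ⟨C * (s/c)^s, fun x hx => (key x hx).trans ?_⟩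
    have hx : 0 < x := hx
    refine mul_le_mul_of_nonneg_left ?_ hC
    have h1 : x ≤ (s/c) * Real.exp (c*x/s) := by
      have := Real.add_one_le_exp (c*x/s)
      calc x = (s/c) * (c*x/s) := by field_simp
        _ ≤ _ := by gcongr; linarith
    have h2 : x^s ≤ (s/c)^s * Real.exp (c*x) := by
      refine (Real.rpow_le_rpow hx.le h1 hs0.le).trans (le_of_eq ?_)
      rw [Real.mul_rpow (by positivity) (by positivity), ← Real.exp_mul]
      congr 2
      field_simp
    rw [Real.rpow_one]
    calc _ ≤ (s/c)^s * Real.exp (c*x) * Real.exp (-c*x) := by gcongr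
      _ = _ := by rw [mul_assoc, ← Real.exp_add]; simp
  · have hi := (integrableOn_rpow_mul_exp_neg_mul_rpow (p := 1) (s := s) (b := c) (by linarith)
      one_pos hc0).const_mul C
    refine Integrable.mono' hi ?_ ?_
    · have := asia_measurable ν h
      exact Measurable.aestronglyMeasurable (by fun_prop)
    · filter_upwards [ae_restrict_mem measurableSet_Ioi] with x hx
      exact key x hx
end
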